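/- There is no function Φ : (ℕ → Bool) × ((ℕ → Bool) → ℕ) × (ℕ → ℕ → ℕ) → ℕ such that: (i) for all X : ℕ → Bool, g : (ℕ → Bool) → ℕ and colourings f of pairs, IF every H : ℕ → Bool contained in X (i.e. H n = true implies X n = true) that is free for f satisfies |H| ≤ g H, THEN |X| ≤ Φ(X, g, f); and (ii) for every g, the map (X, f) ↦ Φ(X, g, f) is continuous. (This is the set-theoretic content of the paper's Theorem that the uniform contraposition UFSP₂ of the free set theorem is equivalent to arithmetical comprehension.) -/

import Mathlib

/-- `H` is free for the colouring `f` of pairs. -/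
def FreeFor (f : ℕ → ℕ → ℕ) (H : ℕ → Bool) : Prop :=
  ∀ k l, k < l → H k = true → H l = true → H (f k l) = true →
    f k l = k ∨ f k l = l

/-- `|Z| ≤ n` : every finite set of naturals contained in `{k | Z k = true}` has
cardinality at most `n`. -/
def CardLe (Z : ℕ → Bool) (n : ℕ) : Prop :=
  ∀ s : Finset ℕ, (∀ k ∈ s, Z k = true) → s.card ≤ n

/-- A set contained in an initial segment has at most as many elements as its `Set.ncard`. -/
theorem cardLe_ncard_of_bounded {H : ℕ → Bool} {n : ℕ} (hH : ∀ k, H k = true → k < n) :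
    CardLe H {k | H k = true}.ncard := by
  intro s hs
  rw [← Set.ncard_coe_finset]
  exact Set.ncard_le_ncard (fun k hk => hs k hk) ((Set.finite_lt_nat n).subset hH)

/-- The initial segments `{k | k < n}` converge to `ℕ` in the space `ℕ → Bool`. -/
theorem tendsto_initialSegment :
    Filter.Tendsto (fun n k : ℕ => decide (k < n)) Filter.atTop (nhds fun _ => true) := by
  rw [tendsto_pi_nhds]
  intro k
  refine tendsto_const_nhds.congr' ?_
  filter_upwards [Filter.eventually_gt_atTop k] with n hn
  simp [hn]

/-- There is no uniform functional for the contraposition `UFSP₂` of the free set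
theorem that is continuous in `(X, f)` for every `g`. -/
theorem no_continuous_uniform_UFSP₂ :
    ¬ ∃ Φ : (ℕ → Bool) × ((ℕ → Bool) → ℕ) × (ℕ → ℕ → ℕ) → ℕ,
      (∀ X : ℕ → Bool, ∀ g : (ℕ → Bool) → ℕ, ∀ f : ℕ → ℕ → ℕ,
        (∀ H : ℕ → Bool, (∀ n, H n = true → X n = true) → FreeFor f H →
          CardLe H (g H)) →
        CardLe X (Φ (X, g, f))) ∧
      (∀ g : (ℕ → Bool) → ℕ,
        Continuous (fun p : (ℕ → Bool) × (ℕ → ℕ → ℕ) => Φ (p.1, g, p.2))) := by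
  rintro ⟨Φ, hΦ, hcont⟩
  let g : (ℕ → Bool) → ℕ := fun H => {k | H k = true}.ncard
  let f : ℕ → ℕ → ℕ := fun _ _ => 0
  have hlim : Filter.Tendsto (fun n : ℕ => Φ (fun k => decide (k < n), g, f)) Filter.atTop
      (nhds (Φ (fun _ => true, g, f))) :=
    ((hcont g).tendsto (fun _ => true, f)).comp
      (tendsto_initialSegment.prodMk_nhds tendsto_const_nhds)
  rw [nhds_discrete, Filter.tendsto_pure] at hlim
  obtain ⟨n, hn, hlt⟩ :=
    (hlim.and (Filter.eventually_gt_atTop (Φ (fun _ => true, g, f)))).exists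
  have hle := hΦ (fun k => decide (k < n)) g f
    (fun H hH _ => cardLe_ncard_of_bounded fun k hk => by simpa using hH k hk)
    (Finset.range n) (by simp)
  rw [Finset.card_range, hn] at hle
  exact hlt.not_ge hle
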